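/- arXiv:math/0204036 — 2 statements merged into one kernel-verified Lean document; each statement's English description precedes it below -/
import Mathlib

section
/- Let a, b, c be pairwise coprime integers, each at least 2. Then g(a, b, c) ≤ (1/2)·( √(abc(a+b+c)) − a − b − c ). -/
/-- Between `v / q` and `2 * v / (q + 1)` there is an integer. -/
lemma exists_int_mul_ge_of_lt {q v : ℤ} (hq : 1 ≤ q) (hqv : q < v) :
    ∃ k : ℤ, 0 ≤ k ∧ v ≤ k * q ∧ k + k * q ≤ 2 * v := by
  have hdiv := Int.mul_ediv_add_emod (v - 1) q
  have hlt := Int.emod_lt_of_pos (v - 1) (by lia : 0 < q)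
  have hnn := Int.emod_nonneg (v - 1) (by lia : q ≠ 0)
  set m := (v - 1) / q
  set r := (v - 1) % q
  have hm : 1 ≤ m := by
    by_contra! hm
    nlinarith
  refine ⟨m + 1, by lia, by nlinarith, ?_⟩
  have hv : v = q * m + r + 1 := by lia
  nlinarith [mul_nonneg (sub_nonneg.2 hm) (sub_nonneg.2 hq)]

/-- Every integer is a combination of two coprime numbers, the first coefficient being reduced. -/
lemma exists_eq_mul_sub_mul {a b : ℤ} (hb : 0 < b) (hab : IsCoprime a b) (t : ℤ) :
    ∃ x v : ℤ, 0 ≤ x ∧ x < b ∧ t = x * a - v * b := by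
  obtain ⟨r, s, hrs⟩ := hab
  refine ⟨t * r % b, -(t * s + t * r / b * a), Int.emod_nonneg _ hb.ne', Int.emod_lt_of_pos _ hb, ?_⟩
  have h := Int.mul_ediv_add_emod (t * r) b
  linear_combination (-t) * hrs - a * h

/-- An integer that is not a nonnegative combination of `a < b` and `c < a + b` satisfies one
of two upper bounds. -/
lemma le_or_le_of_not_representable {a b c t : ℤ} (ha : 2 ≤ a) (hlt : a < b)
    (hc : c < a + b) (hab : IsCoprime a b) (hac : IsCoprime a c) (hbc : IsCoprime b c)
    (h : ∀ x y z : ℤ, 0 ≤ x → 0 ≤ y → 0 ≤ z → t ≠ x * a + y * b + z * c) :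
    3 * t ≤ 2 * a * b - 2 * a ∨ 2 * t ≤ 2 * a * b - a ^ 2 - 2 * b := by
  obtain ⟨x, v, hx0, hxb, ht⟩ := exists_eq_mul_sub_mul (by lia) hab t
  obtain ⟨α, q, hα0, hαb, hcα⟩ := exists_eq_mul_sub_mul (by lia) hab c
  have hv : 1 ≤ v := by
    by_contra! hv
    exact h x (-v) 0 hx0 (by lia) le_rfl (by linear_combination ht)
  have not_dvd {d : ℤ} (hd : 2 ≤ d) (hdc : IsCoprime d c) : ¬ d ∣ c := fun hdvd => by
    have := Int.isUnit_iff.1 (hdc.isUnit_of_dvd' dvd_rfl hdvd)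
    lia
  have hq : 1 ≤ q := by
    by_contra! hq
    rcases hα0.eq_or_lt with h0 | h0
    · exact not_dvd (by lia) hbc ⟨-q, by rw [hcα, ← h0]; ring⟩
    · rcases (show q ≤ 0 by lia).eq_or_lt with h1 | h1
      · exact not_dvd ha hac ⟨α, by rw [hcα, h1]; ring⟩
      · nlinarith
  obtain hqv | hvq := lt_or_ge q v
  · left
    obtain ⟨k, hk0, hk1, hk2⟩ := exists_int_mul_ge_of_lt hq hqv
    have hxk : x < k * α := by
      by_contra! hxk
      exact h (x - k * α) (k * q - v) k (by lia) (by lia) hk0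
        (by linear_combination ht + (-k) * hcα)
    have h1 : x * a < k * (α * a) := by nlinarith
    have h2 : k * (α * a) ≤ k * (a + b + q * b) := by gcongr; lia
    have h3 : k * a ≤ v * a := by nlinarith
    have h4 : (k + k * q) * b ≤ 2 * v * b := by nlinarith
    nlinarith
  · right
    have hpu : b - α < b - x := by
      by_contra! hpu
      exact h (x - α) (q - v) 1 (by lia) (by lia) one_pos.le (by linear_combination ht - hcα)
    obtain ⟨k, hk0, hk1, hk2⟩ := exists_int_mul_ge_of_lt (by lia : 1 ≤ b - α) hpu
    have hvk : a - v < k * (a - q) := by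
      by_contra! hvk
      exact h (k * (b - α) - (b - x)) (a - v - k * (a - q)) k (by lia) (by lia) hk0
        (by linear_combination ht - k * hcα)
    have hβ : a - q ≤ b - α + 1 := by
      by_contra! hβ
      nlinarith
    have h1 : k * (a - q) ≤ k * (b - α + 1) := by gcongr
    have h2 : a - v + 1 ≤ 2 * (b - x) := by lia
    nlinarith

lemma sq_le_of_not_representable {a b c t : ℤ} (ha : 2 ≤ a) (hlt : a < b) (hbc' : b < c)
    (hab : IsCoprime a b) (hac : IsCoprime a c) (hbc : IsCoprime b c) (ht : 0 ≤ t)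
    (h : ∀ x y z : ℤ, 0 ≤ x → 0 ≤ y → 0 ≤ z → t ≠ x * a + y * b + z * c) :
    (2 * t + a + b + c) ^ 2 ≤ a * b * c * (a + b + c) := by
  have htwo : t ≤ a * b - a - b := by
    obtain ⟨x, v, hx0, hxb, ht⟩ := exists_eq_mul_sub_mul (by lia) hab t
    have hv : 1 ≤ v := by
      by_contra! hv
      exact h x (-v) 0 hx0 (by lia) le_rfl (by linear_combination ht)
    nlinarith
  obtain hc | hc := le_or_gt (a + b) c
  · have h1 : (2 * t + a + b + c) ^ 2 ≤ (2 * (a * b) + (c - a - b)) ^ 2 :=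
      pow_le_pow_left₀ (by lia) (by lia) 2
    refine h1.trans ?_
    obtain ⟨d, rfl⟩ : ∃ d, c = a + b + d := ⟨c - a - b, by ring⟩
    have hd : 0 ≤ d := by lia
    have hab0 : 0 ≤ a * b := by nlinarith
    have hab1 : 1 ≤ a * b := by nlinarith
    have e1 : a * b * (4 * (a * b)) ≤ a * b * (2 * (a + b) ^ 2) :=
      mul_le_mul_of_nonneg_left (by nlinarith [sq_nonneg (a - b)]) hab0
    have e2 : a * b * d * 4 ≤ a * b * d * (3 * (a + b)) :=
      mul_le_mul_of_nonneg_left (by lia) (by positivity)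
    have e3 : 1 * d ^ 2 ≤ a * b * d ^ 2 := mul_le_mul_of_nonneg_right hab1 (by positivity)
    linarith
  obtain hb | hb := lt_or_ge (3 * a) (2 * b)
  · calc (2 * t + a + b + c) ^ 2 ≤ (2 * (a * b)) ^ 2 := pow_le_pow_left₀ (by lia) (by lia) 2
      _ = a * b * (4 * a * b) := by ring
      _ ≤ a * b * (c * (a + b + c)) :=
        mul_le_mul_of_nonneg_left (by nlinarith) (by nlinarith)
      _ = a * b * c * (a + b + c) := by ring
  have h1 : 3 * t ≤ 2 * (a * b) - 2 * a := by
    obtain h1 | h1 := le_or_le_of_not_representable ha hlt hc hab hac hbc h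
    · lia
    · nlinarith
  have h2 : (3 * (2 * t + a + b + c)) ^ 2 ≤ (4 * (a * b) - a + 3 * b + 3 * c) ^ 2 :=
    pow_le_pow_left₀ (by lia) (by lia) 2
  suffices (4 * (a * b) - a + 3 * b + 3 * c) ^ 2 ≤ 9 * (a * b * c * (a + b + c)) by linarith
  obtain ⟨x, rfl⟩ : ∃ x, a = 2 + x := ⟨a - 2, by ring⟩
  obtain ⟨y, rfl⟩ : ∃ y, b = 2 + x + 1 + y := ⟨b - (2 + x) - 1, by ring⟩
  obtain ⟨z, rfl⟩ : ∃ z, c = 2 + x + 1 + y + 1 + z := ⟨c - (2 + x + 1 + y) - 1, by ring⟩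
  have hx : 0 ≤ x := by lia
  have hy : 0 ≤ y := by lia
  have hz : 0 ≤ z := by lia
  rw [← sub_nonneg]
  ring_nf
  positivity

lemma le_sqrt_of_not_representable {a b c t : ℕ} (ha : 2 ≤ a) (hb : 2 ≤ b) (hc : 2 ≤ c)
    (hab : Nat.Coprime a b) (hac : Nat.Coprime a c) (hbc : Nat.Coprime b c)
    (h : ¬ ∃ x y z : ℕ, t = x * a + y * b + z * c) :
    (t : ℝ) ≤ (1 / 2) * (Real.sqrt (a * b * c * (a + b + c)) - a - b - c) := by
  wlog hlt : a ≤ b generalizing a b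
  · have := this hb ha hab.symm hbc hac
      (fun ⟨x, y, z, e⟩ => h ⟨y, x, z, by lia⟩) (by lia)
    convert this using 1
    rw [mul_comm (b : ℝ) a, add_comm (b : ℝ) a]
    ring
  wlog hlt' : b ≤ c generalizing a b c
  · obtain hac' | hac' := le_total a c
    · have := this hb ha hc hac hab hbc.symm
        (fun ⟨x, y, z, e⟩ => h ⟨x, z, y, by lia⟩) hac' (by lia)
      convert this using 1
      rw [mul_right_comm (a : ℝ) c b, add_right_comm (a : ℝ) c b]
      ring
    · have := this hb hc ha hac.symm hbc.symm hab
        (fun ⟨x, y, z, e⟩ => h ⟨y, z, x, by lia⟩) hac' (by lia)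
      convert this using 1
      rw [show (c : ℝ) * a * b * (c + a + b) = a * b * c * (a + b + c) by ring]
      ring
  have ne_of_coprime {m n : ℕ} (hm : 2 ≤ m) (hmn : Nat.Coprime m n) : m ≠ n := by
    rintro rfl
    rw [Nat.coprime_self] at hmn
    lia
  have key := sq_le_of_not_representable (a := a) (b := b) (c := c) (t := t) (by lia)
    (by have := ne_of_coprime ha hab; lia) (by have := ne_of_coprime hb hbc; lia)
    hab.isCoprime hac.isCoprime hbc.isCoprime (by lia)
    (fun x y z hx hy hz e => by
      lift x to ℕ using hx
      lift y to ℕ using hy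
      lift z to ℕ using hz
      exact h ⟨x, y, z, by exact_mod_cast e⟩)
  have := Real.le_sqrt_of_sq_le (x := 2 * t + a + b + c) (y := a * b * c * (a + b + c))
    (by exact_mod_cast key)
  linarith


/-- For pairwise coprime integers `a, b, c ≥ 2`, the Frobenius number
satisfies `g(a,b,c) ≤ (1/2)(√(abc(a+b+c)) - a - b - c)`. -/
theorem frobenius_upper_bound (a b c : ℕ) (ha : 2 ≤ a) (hb : 2 ≤ b) (hc : 2 ≤ c)
    (hab : Nat.Coprime a b) (hac : Nat.Coprime a c) (hbc : Nat.Coprime b c)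
    (g : ℕ)
    (hg : IsGreatest {t : ℕ | ¬ ∃ x y z : ℕ, t = x * a + y * b + z * c} g) :
    (g : ℝ) ≤ (1 / 2) * (Real.sqrt (a * b * c * (a + b + c)) - a - b - c) := by
  exact le_sqrt_of_not_representable ha hb hc hab hac hbc hg.1
end

section
/- Let a, b, c be pairwise coprime positive integers and t a nonnegative integer. Then, as an identity of complex numbers, N_t(a,b,c) = t²/(2abc) + (t/2)·(1/(ab) + 1/(ac) + 1/(bc)) + (1/12)·(3/a + 3/b + 3/c + a/(bc) + b/(ac) + c/(ab)) + σ_{−t}(b,c;a) + σ_{−t}(a,c;b) + σ_{−t}(a,b;c). -/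
open Complex Real Finset

/-- The number of representations of `t` as a nonnegative integer combination
`a*m₁ + b*m₂ + c*m₃`. -/
noncomputable def frobN (a b c t : ℕ) : ℕ :=
  Nat.card {p : ℕ × ℕ × ℕ // a * p.1 + b * p.2.1 + c * p.2.2 = t}

/-- The Fourier–Dedekind sum `σ_t(a,b;c) = (1/c) ∑_{λ^c = 1, λ ≠ 1}
λ^t / ((λ^a - 1)(λ^b - 1))`, where the nontrivial `c`-th roots of unity are
parametrized as `λ = e^{2πik/c}`, `1 ≤ k ≤ c-1`. -/
noncomputable def fourierDedekind (t : ℤ) (a b c : ℕ) : ℂ :=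
  (1 / (c : ℂ)) * ∑ k ∈ Finset.Icc 1 (c - 1),
    Complex.exp (2 * Real.pi * Complex.I * k / c) ^ t /
      ((Complex.exp (2 * Real.pi * Complex.I * k / c) ^ (a : ℕ) - 1) *
        (Complex.exp (2 * Real.pi * Complex.I * k / c) ^ (b : ℕ) - 1))

section Polynomials

open Polynomial

/-- The nontrivial complex `n`-th roots of unity. -/
noncomputable def nontrivialRoots (n : ℕ) : Finset ℂ :=
  (nthRootsFinset n (1 : ℂ)).erase 1

theorem mem_nontrivialRoots {n : ℕ} (hn : 0 < n) {z : ℂ} :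
    z ∈ nontrivialRoots n ↔ z ≠ 1 ∧ z ^ n = 1 := by
  rw [nontrivialRoots, Finset.mem_erase, mem_nthRootsFinset hn]

theorem card_nontrivialRoots {n : ℕ} (hn : 0 < n) : (nontrivialRoots n).card = n - 1 := by
  rw [nontrivialRoots, Finset.card_erase_of_mem ((mem_nthRootsFinset hn _).2 (one_pow n)),
    (Complex.isPrimitiveRoot_exp n hn.ne').card_nthRootsFinset]

theorem pow_ne_one_of_mem_nontrivialRoots {m n : ℕ} (hn : 0 < n) (h : Nat.Coprime m n) {z : ℂ}
    (hz : z ∈ nontrivialRoots n) : z ^ m ≠ 1 := by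
  obtain ⟨h1, h2⟩ := (mem_nontrivialRoots hn).1 hz
  intro h3
  apply h1
  have := Nat.dvd_gcd (orderOf_dvd_of_pow_eq_one h3) (orderOf_dvd_of_pow_eq_one h2)
  rw [h.gcd_eq_one, Nat.dvd_one] at this
  exact orderOf_eq_one_iff.1 this

theorem disjoint_nontrivialRoots {m n : ℕ} (hm : 0 < m) (hn : 0 < n) (h : Nat.Coprime m n) :
    Disjoint (nontrivialRoots m) (nontrivialRoots n) :=
  Finset.disjoint_left.2 fun _ h1 h2 =>
    pow_ne_one_of_mem_nontrivialRoots hn h h2 ((mem_nontrivialRoots hm).1 h1).2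

theorem nontrivialRoots_eq_image {n : ℕ} (hn : 0 < n) {ζ : ℂ} (hζ : IsPrimitiveRoot ζ n) :
    nontrivialRoots n = (Finset.Icc 1 (n - 1)).image (ζ ^ ·) := by
  ext z
  rw [mem_nontrivialRoots hn, Finset.mem_image]
  constructor
  · rintro ⟨h1, h2⟩
    have : NeZero n := ⟨hn.ne'⟩
    obtain ⟨i, hi, rfl⟩ := hζ.eq_pow_of_pow_eq_one h2
    refine ⟨i, Finset.mem_Icc.2 ⟨?_, by omega⟩, rfl⟩
    rcases Nat.eq_zero_or_pos i with rfl | h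
    · simp at h1
    · exact h
  · rintro ⟨i, hi, rfl⟩
    rw [Finset.mem_Icc] at hi
    exact ⟨hζ.pow_ne_one_of_pos_of_lt (by omega) (by omega),
      by rw [← pow_mul, mul_comm, pow_mul, hζ.pow_eq_one, one_pow]⟩

theorem fourierDedekind_eq_sum_nontrivialRoots (t : ℤ) (a b : ℕ) {c : ℕ} (hc : 0 < c) :
    fourierDedekind t a b c =
      (1 / (c : ℂ)) * ∑ z ∈ nontrivialRoots c, z ^ t / ((z ^ a - 1) * (z ^ b - 1)) := by
  have hζ := Complex.isPrimitiveRoot_exp c hc.ne'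
  rw [fourierDedekind, nontrivialRoots_eq_image hc hζ, Finset.sum_image]
  · congr 1
    refine Finset.sum_congr rfl fun k _ => ?_
    have : Complex.exp (2 * Real.pi * Complex.I * k / c) =
        Complex.exp (2 * Real.pi * Complex.I / c) ^ k := by
      rw [← Complex.exp_nat_mul]
      congr 1
      ring
    rw [this]
  · intro i hi j hj hij
    simp only [Finset.coe_Icc, Set.mem_Icc] at hi hj
    exact hζ.pow_inj (by omega) (by omega) hij

/-- The polynomial `∑_{j < n} (μ X)^j = (1 - (μ X)^n) / (1 - μ X)`. -/
noncomputable def geomPoly (μ : ℂ) (n : ℕ) : ℂ[X] :=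
  ∑ j ∈ Finset.range n, (C μ * X) ^ j

theorem one_sub_mul_geomPoly (μ : ℂ) (n : ℕ) :
    (1 - C μ * X) * geomPoly μ n = 1 - (C μ * X) ^ n :=
  mul_neg_geom_sum _ _

theorem natDegree_geomPoly_le (μ : ℂ) (n : ℕ) : (geomPoly μ n).natDegree ≤ n - 1 := by
  refine natDegree_sum_le_of_forall_le _ _ fun i hi => ?_
  rw [Finset.mem_range] at hi
  calc ((C μ * X) ^ i).natDegree ≤ i * (C μ * X).natDegree := natDegree_pow_le
    _ ≤ i * 1 := Nat.mul_le_mul_left _ (by simpa using natDegree_C_mul_X_pow_le μ 1)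
    _ ≤ n - 1 := by omega

theorem eval_geomPoly_inv_self {n : ℕ} {z : ℂ} (hz : z ≠ 0) : (geomPoly z⁻¹ n).eval z = n := by
  simp [geomPoly, eval_finsetSum, hz]

theorem eval_geomPoly_eq_zero {n : ℕ} {μ w : ℂ} (hμ : μ ^ n = 1) (hw : w ^ n = 1)
    (h : μ * w ≠ 1) : (geomPoly μ n).eval w = 0 := by
  have := congrArg (eval w) (one_sub_mul_geomPoly μ n)
  simp only [eval_mul, eval_sub, eval_one, eval_C, eval_X, eval_pow, mul_pow, hμ, hw, mul_one,
    sub_self] at this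
  exact (mul_eq_zero.1 this).resolve_left (sub_ne_zero.2 h.symm)

theorem X_sub_one_cube_dvd_X_pow_sub (n : ℕ) :
    (X - 1 : ℂ[X]) ^ 3 ∣ X ^ n -
      (1 + C (n : ℂ) * (X - 1) + C ((n : ℂ) * (n - 1) / 2) * (X - 1) ^ 2) := by
  induction n with
  | zero => simp
  | succ n ih =>
    obtain ⟨r, hr⟩ := ih
    refine ⟨r * X + C ((n : ℂ) * (n - 1) / 2), ?_⟩
    have h : C ((↑(n + 1) : ℂ) * (↑(n + 1) - 1) / 2) =
        C ((n : ℂ) * (n - 1) / 2) + C (n : ℂ) := by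
      rw [← C_add]; congr 1; push_cast; ring
    have h' : C (↑(n + 1) : ℂ) = C (n : ℂ) + 1 := by simp
    rw [h, h', pow_succ, eq_add_of_sub_eq hr]
    ring

theorem X_sub_one_cube_dvd_geomPoly_one_sub (n : ℕ) :
    (X - 1 : ℂ[X]) ^ 3 ∣ geomPoly 1 n - (C (n : ℂ) + C ((n : ℂ) * (n - 1) / 2) * (X - 1) +
      C ((n : ℂ) * (n - 1) * (n - 2) / 6) * (X - 1) ^ 2) := by
  induction n with
  | zero => simp [geomPoly]
  | succ n ih =>
    have h := dvd_add ih (X_sub_one_cube_dvd_X_pow_sub n)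
    convert h using 1
    have h1 : C ((↑(n + 1) : ℂ) * (↑(n + 1) - 1) / 2) =
        C ((n : ℂ) * (n - 1) / 2) + C (n : ℂ) := by
      rw [← C_add]; congr 1; push_cast; ring
    have h2 : C ((↑(n + 1) : ℂ) * (↑(n + 1) - 1) * (↑(n + 1) - 2) / 6) =
        C ((n : ℂ) * (n - 1) * (n - 2) / 6) + C ((n : ℂ) * (n - 1) / 2) := by
      rw [← C_add]; congr 1; push_cast; ring
    have h3 : C (↑(n + 1) : ℂ) = C (n : ℂ) + 1 := by simp
    have h4 : geomPoly 1 (n + 1) = geomPoly 1 n + X ^ n := by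
      simp [geomPoly, Finset.sum_range_succ]
    rw [h1, h2, h3, h4]
    ring

/-- The numerator, over the denominator `(1 - X^a)(1 - X^b)(1 - X^c)`, of the partial fractions
at the nontrivial `c`-th roots of unity. -/
noncomputable def rootNumerator (a b c : ℕ) : ℂ[X] :=
  (1 - X ^ a) * (1 - X ^ b) *
    ∑ z ∈ nontrivialRoots c, C (1 / (c * ((z ^ a - 1) * (z ^ b - 1)))) * geomPoly z⁻¹ c

section rootNumerator

variable {a b c : ℕ}

theorem eval_rootNumerator_eq_one (hc : 0 < c) (hac : Nat.Coprime a c) (hbc : Nat.Coprime b c)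
    {w : ℂ} (hw : w ∈ nontrivialRoots c) : (rootNumerator a b c).eval w = 1 := by
  have hwa := sub_ne_zero.2 (pow_ne_one_of_mem_nontrivialRoots hc hac hw)
  have hwb := sub_ne_zero.2 (pow_ne_one_of_mem_nontrivialRoots hc hbc hw)
  have hwc := ((mem_nontrivialRoots hc).1 hw).2
  have hc0 : (c : ℂ) ≠ 0 := Nat.cast_ne_zero.2 hc.ne'
  have hw0 : w ≠ 0 := by
    rintro rfl
    simp [hc.ne'] at hwc
  simp only [rootNumerator, eval_mul, eval_sub, eval_one, eval_pow, eval_X, eval_finsetSum, eval_C]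
  rw [Finset.sum_eq_single w]
  · rw [eval_geomPoly_inv_self hw0]
    field_simp
    ring
  · intro z hz hzw
    have hzc := ((mem_nontrivialRoots hc).1 hz).2
    have hz0 : z ≠ 0 := by
      rintro rfl
      simp [hc.ne'] at hzc
    rw [eval_geomPoly_eq_zero (by rw [inv_pow, hzc, inv_one]) hwc, mul_zero]
    intro h
    exact hzw (by field_simp at h; exact h.symm)
  · exact fun h => absurd hw h

theorem eval_rootNumerator_eq_zero {w : ℂ} (hw : w ^ a = 1 ∨ w ^ b = 1) :
    (rootNumerator a b c).eval w = 0 := by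
  rcases hw with h | h <;> simp [rootNumerator, h]

theorem X_sub_one_dvd_one_sub_X_pow (n : ℕ) : (X - 1 : ℂ[X]) ∣ 1 - X ^ n := by
  rw [dvd_sub_comm]
  exact sub_one_dvd_pow_sub_one X n

theorem X_sub_one_cube_dvd_rootNumerator (hc : 0 < c) :
    (X - 1 : ℂ[X]) ^ 3 ∣ rootNumerator a b c := by
  have h : (X - 1 : ℂ[X]) ∣
      ∑ z ∈ nontrivialRoots c, C (1 / (c * ((z ^ a - 1) * (z ^ b - 1)))) * geomPoly z⁻¹ c := by
    refine Finset.dvd_sum fun z hz => Dvd.dvd.mul_left ?_ _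
    obtain ⟨hz1, hzc⟩ := (mem_nontrivialRoots hc).1 hz
    rw [← C_1, dvd_iff_isRoot]
    refine eval_geomPoly_eq_zero (by rw [inv_pow, hzc, inv_one]) (one_pow c) ?_
    simpa using hz1
  rw [show (X - 1 : ℂ[X]) ^ 3 = (X - 1) * (X - 1) * (X - 1) by ring]
  exact mul_dvd_mul (mul_dvd_mul (X_sub_one_dvd_one_sub_X_pow a) (X_sub_one_dvd_one_sub_X_pow b)) h

theorem natDegree_one_sub_X_pow_le (n : ℕ) : (1 - X ^ n : ℂ[X]).natDegree ≤ n := by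
  refine (natDegree_sub_le _ _).trans ?_
  simp

theorem natDegree_rootNumerator_le (hc : 0 < c) :
    (rootNumerator a b c).natDegree ≤ a + b + c - 1 := by
  have h : (∑ z ∈ nontrivialRoots c,
      C (1 / (c * ((z ^ a - 1) * (z ^ b - 1)))) * geomPoly z⁻¹ c).natDegree ≤ c - 1 :=
    natDegree_sum_le_of_forall_le _ _ fun z _ =>
      (natDegree_C_mul_le _ _).trans (natDegree_geomPoly_le _ _)
  have h1 := natDegree_mul_le_of_le (natDegree_mul_le_of_le (natDegree_one_sub_X_pow_le a)
    (natDegree_one_sub_X_pow_le b)) h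
  exact h1.trans (by omega)

end rootNumerator

/-- The constant term of the polynomial part of the counting function. -/
noncomputable def frobConst (a b c : ℕ) : ℂ :=
  (1 / 12) * (3 / a + 3 / b + 3 / c + a / (b * c) + b / (a * c) + c / (a * b))

/-- The numerator, over the denominator `(1 - X^a)(1 - X^b)(1 - X^c)`, of the principal part
at `1`. -/
noncomputable def oneNumerator (a b c : ℕ) : ℂ[X] :=
  geomPoly 1 a * geomPoly 1 b * geomPoly 1 c *
    (C (1 / (a * b * c : ℂ)) + C ((a + b + c - 3) / (2 * a * b * c) : ℂ) * (1 - X) +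
      C (frobConst a b c - (a + b + c - 3) / (2 * a * b * c) - 1 / (a * b * c)) * (1 - X) ^ 2)

section oneNumerator

variable {a b c : ℕ}

theorem eval_oneNumerator_eq_zero {w : ℂ} (hw : w ≠ 1) (h : w ^ a = 1 ∨ w ^ b = 1 ∨ w ^ c = 1) :
    (oneNumerator a b c).eval w = 0 := by
  have key {n : ℕ} (hn : w ^ n = 1) : (geomPoly 1 n).eval w = 0 :=
    eval_geomPoly_eq_zero (one_pow n) hn (by simpa using hw)
  rcases h with h | h | h <;> simp [oneNumerator, eval_mul, key h]

theorem natDegree_oneNumerator_le (ha : 0 < a) (hb : 0 < b) (hc : 0 < c) :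
    (oneNumerator a b c).natDegree ≤ a + b + c - 1 := by
  have h1 : (1 - X : ℂ[X]).natDegree ≤ 1 := by simpa using natDegree_one_sub_X_pow_le 1
  have h2 (r s t : ℂ) : (C r + C s * (1 - X) + C t * (1 - X) ^ 2 : ℂ[X]).natDegree ≤ 2 := by
    refine natDegree_add_le_of_degree_le (natDegree_add_le_of_degree_le (by simp) ?_) ?_
    · exact (natDegree_C_mul_le _ _).trans (h1.trans (by norm_num))
    · exact (natDegree_C_mul_le _ _).trans (natDegree_pow_le_of_le 2 h1)
  have h3 := natDegree_mul_le_of_le (natDegree_mul_le_of_le (natDegree_mul_le_of_le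
    (natDegree_geomPoly_le 1 a) (natDegree_geomPoly_le 1 b)) (natDegree_geomPoly_le 1 c))
    (h2 (1 / (a * b * c : ℂ)) ((a + b + c - 3) / (2 * a * b * c) : ℂ)
      (frobConst a b c - (a + b + c - 3) / (2 * a * b * c) - 1 / (a * b * c)))
  exact h3.trans (by omega)

theorem X_sub_one_cube_dvd_oneNumerator_sub_one (ha : 0 < a) (hb : 0 < b) (hc : 0 < c) :
    (X - 1 : ℂ[X]) ^ 3 ∣ oneNumerator a b c - 1 := by
  have ha0 : (a : ℂ) ≠ 0 := Nat.cast_ne_zero.2 ha.ne'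
  have hb0 : (b : ℂ) ≠ 0 := Nat.cast_ne_zero.2 hb.ne'
  have hc0 : (c : ℂ) ≠ 0 := Nat.cast_ne_zero.2 hc.ne'
  obtain ⟨ra, hra⟩ := X_sub_one_cube_dvd_geomPoly_one_sub a
  obtain ⟨rb, hrb⟩ := X_sub_one_cube_dvd_geomPoly_one_sub b
  obtain ⟨rc, hrc⟩ := X_sub_one_cube_dvd_geomPoly_one_sub c
  have reduce (p0 p1 p2 q0 q1 q2 r0 r1 r2 s0 s1 s2 : ℂ)
      (h0 : p0 * q0 * r0 * s0 = 1)
      (h1 : p1 * q0 * r0 * s0 + p0 * q1 * r0 * s0 + p0 * q0 * r1 * s0 = p0 * q0 * r0 * s1)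
      (h2 : p2 * q0 * r0 * s0 + p0 * q2 * r0 * s0 + p0 * q0 * r2 * s0 + p1 * q1 * r0 * s0 +
        p1 * q0 * r1 * s0 + p0 * q1 * r1 * s0 + p0 * q0 * r0 * s2 =
        (p1 * q0 * r0 + p0 * q1 * r0 + p0 * q0 * r1) * s1) :
      (X - 1 : ℂ[X]) ^ 3 ∣ (C p0 + C p1 * (X - 1) + C p2 * (X - 1) ^ 2) *
        (C q0 + C q1 * (X - 1) + C q2 * (X - 1) ^ 2) *
        (C r0 + C r1 * (X - 1) + C r2 * (X - 1) ^ 2) *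
        (C s0 + C s1 * (1 - X) + C s2 * (1 - X) ^ 2) - 1 := by
    have h0 := congrArg C h0
    have h1 := congrArg C h1
    have h2 := congrArg C h2
    simp only [C_mul, C_add, C_1] at h0 h1 h2
    generalize C p0 = p0 at *
    generalize C p1 = p1 at *
    generalize C p2 = p2 at *
    generalize C q0 = q0 at *
    generalize C q1 = q1 at *
    generalize C q2 = q2 at *
    generalize C r0 = r0 at *
    generalize C r1 = r1 at *
    generalize C r2 = r2 at *
    generalize C s0 = s0 at *
    generalize C s1 = s1 at *
    generalize C s2 = s2 at *
    obtain ⟨w, hw⟩ : ∃ w : ℂ[X], w = X - 1 := ⟨_, rfl⟩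
    rw [← neg_sub (X : ℂ[X]) 1, ← hw]
    set u3 := p2 * q1 * r0 + p2 * q0 * r1 + p1 * q2 * r0 + p0 * q2 * r1 + p1 * q0 * r2 +
      p0 * q1 * r2 + p1 * q1 * r1 with hu3
    set u4 := p2 * q2 * r0 + p2 * q0 * r2 + p0 * q2 * r2 + p2 * q1 * r1 + p1 * q2 * r1 +
      p1 * q1 * r2 with hu4
    set u5 := p2 * q2 * r1 + p2 * q1 * r2 + p1 * q2 * r2 with hu5
    set u2 := p2 * q0 * r0 + p0 * q2 * r0 + p0 * q0 * r2 + p1 * q1 * r0 + p1 * q0 * r1 +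
      p0 * q1 * r1 with hu2
    set u1 := p1 * q0 * r0 + p0 * q1 * r0 + p0 * q0 * r1 with hu1
    refine ⟨u3 * s0 - u2 * s1 + u1 * s2 + w * (u4 * s0 - u3 * s1 + u2 * s2) +
      w ^ 2 * (u5 * s0 - u4 * s1 + u3 * s2) +
      w ^ 3 * (p2 * q2 * r2 * s0 - u5 * s1 + u4 * s2) +
      w ^ 4 * (- p2 * q2 * r2 * s1 + u5 * s2) + w ^ 5 * (p2 * q2 * r2 * s2), ?_⟩
    rw [hu1, hu2, hu3, hu4, hu5]
    linear_combination h0 + w * h1 + w ^ 2 * h2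
  have main := reduce a (a * (a - 1) / 2) (a * (a - 1) * (a - 2) / 6)
    b (b * (b - 1) / 2) (b * (b - 1) * (b - 2) / 6)
    c (c * (c - 1) / 2) (c * (c - 1) * (c - 2) / 6)
    (1 / (a * b * c)) ((a + b + c - 3) / (2 * a * b * c))
    (frobConst a b c - (a + b + c - 3) / (2 * a * b * c) - 1 / (a * b * c))
    (by field_simp) (by field_simp; ring) (by rw [frobConst]; field_simp; ring)
  rw [oneNumerator, eq_add_of_sub_eq hra, eq_add_of_sub_eq hrb, eq_add_of_sub_eq hrc]
  set p := C (a : ℂ) + C ((a : ℂ) * (a - 1) / 2) * (X - 1) +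
    C ((a : ℂ) * (a - 1) * (a - 2) / 6) * (X - 1) ^ 2
  set q := C (b : ℂ) + C ((b : ℂ) * (b - 1) / 2) * (X - 1) +
    C ((b : ℂ) * (b - 1) * (b - 2) / 6) * (X - 1) ^ 2
  set r := C (c : ℂ) + C ((c : ℂ) * (c - 1) / 2) * (X - 1) +
    C ((c : ℂ) * (c - 1) * (c - 2) / 6) * (X - 1) ^ 2
  set s := C (1 / (a * b * c : ℂ)) + C ((a + b + c - 3) / (2 * a * b * c) : ℂ) * (1 - X) +
      C (frobConst a b c - (a + b + c - 3) / (2 * a * b * c) - 1 / (a * b * c)) * (1 - X) ^ 2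
  obtain ⟨v, hv⟩ := main
  refine ⟨v + s * (ra * ((X - 1) ^ 3 * rb + q) * ((X - 1) ^ 3 * rc + r) +
    p * rb * ((X - 1) ^ 3 * rc + r) + p * q * rc), ?_⟩
  linear_combination hv

end oneNumerator

theorem eq_zero_of_X_sub_one_cube_dvd {p : ℂ[X]} (h : (X - 1 : ℂ[X]) ^ 3 ∣ p) {s : Finset ℂ}
    (hs : 1 ∉ s) (hdeg : p.natDegree < s.card + 3) (hp : ∀ w ∈ s, p.eval w = 0) : p = 0 := by
  obtain ⟨q, rfl⟩ := h
  by_cases hq : q = 0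
  · simp [hq]
  refine absurd ?_ hq
  have hmonic : ((X - 1 : ℂ[X]) ^ 3).Monic := by
    rw [← C_1]
    exact (monic_X_sub_C 1).pow 3
  have h3 : ((X - 1 : ℂ[X]) ^ 3).natDegree = 3 := by
    rw [← C_1, natDegree_pow, natDegree_X_sub_C]
  rw [hmonic.natDegree_mul' hq, h3] at hdeg
  refine eq_zero_of_natDegree_lt_card_of_eval_eq_zero' q s (fun w hw => ?_) (by omega)
  have := hp w hw
  rw [eval_mul] at this
  refine (mul_eq_zero.1 this).resolve_left ?_
  have hw1 : w ≠ 1 := fun h => hs (h ▸ hw)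
  simpa using sub_ne_zero.2 hw1

/-- The partial fraction decomposition of `1 / ((1 - X^a)(1 - X^b)(1 - X^c))`, cleared of
denominators. -/
theorem oneNumerator_add_rootNumerator {a b c : ℕ} (ha : 0 < a) (hb : 0 < b) (hc : 0 < c)
    (hab : Nat.Coprime a b) (hac : Nat.Coprime a c) (hbc : Nat.Coprime b c) :
    oneNumerator a b c + rootNumerator b c a + rootNumerator a c b + rootNumerator a b c = 1 := by
  classical
  rw [← sub_eq_zero]
  set s := nontrivialRoots a ∪ nontrivialRoots b ∪ nontrivialRoots c with hs
  have hcard : s.card = (a - 1) + (b - 1) + (c - 1) := by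
    rw [hs, Finset.card_union_of_disjoint (Finset.disjoint_union_left.2
      ⟨disjoint_nontrivialRoots ha hc hac, disjoint_nontrivialRoots hb hc hbc⟩),
      Finset.card_union_of_disjoint (disjoint_nontrivialRoots ha hb hab),
      card_nontrivialRoots ha, card_nontrivialRoots hb, card_nontrivialRoots hc]
  refine eq_zero_of_X_sub_one_cube_dvd (s := s) ?_ ?_ ?_ ?_
  · convert dvd_add (dvd_add (dvd_add (X_sub_one_cube_dvd_oneNumerator_sub_one ha hb hc)
      (X_sub_one_cube_dvd_rootNumerator (a := b) (b := c) ha))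
      (X_sub_one_cube_dvd_rootNumerator (a := a) (b := c) hb))
      (X_sub_one_cube_dvd_rootNumerator (a := a) (b := b) hc) using 1
    ring
  · simp [hs, nontrivialRoots]
  · have hdeg : (oneNumerator a b c + rootNumerator b c a + rootNumerator a c b +
        rootNumerator a b c - 1).natDegree ≤ a + b + c - 1 := by
      refine natDegree_sub_le_of_le (natDegree_add_le_of_degree_le (natDegree_add_le_of_degree_le
        (natDegree_add_le_of_degree_le (natDegree_oneNumerator_le ha hb hc) ?_) ?_)
        (natDegree_rootNumerator_le hc)) (by simp) |>.trans (max_self _).le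
      · exact (natDegree_rootNumerator_le ha).trans (by omega)
      · exact (natDegree_rootNumerator_le hb).trans (by omega)
    omega
  · intro w hw
    simp only [hs, Finset.mem_union] at hw
    simp only [eval_sub, eval_add, eval_one]
    rcases hw with (hw | hw) | hw
    · obtain ⟨h1, h2⟩ := (mem_nontrivialRoots ha).1 hw
      rw [eval_oneNumerator_eq_zero h1 (.inl h2), eval_rootNumerator_eq_one ha hab.symm hac.symm hw,
        eval_rootNumerator_eq_zero (.inl h2), eval_rootNumerator_eq_zero (.inl h2)]
      ring
    · obtain ⟨h1, h2⟩ := (mem_nontrivialRoots hb).1 hw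
      rw [eval_oneNumerator_eq_zero h1 (.inr (.inl h2)), eval_rootNumerator_eq_zero (.inl h2),
        eval_rootNumerator_eq_one hb hab hbc.symm hw, eval_rootNumerator_eq_zero (.inr h2)]
      ring
    · obtain ⟨h1, h2⟩ := (mem_nontrivialRoots hc).1 hw
      rw [eval_oneNumerator_eq_zero h1 (.inr (.inr h2)), eval_rootNumerator_eq_zero (.inr h2),
        eval_rootNumerator_eq_zero (.inr h2), eval_rootNumerator_eq_one hc hac hbc hw]
      ring

end Polynomials

section PowerSeries

open PowerSeries

theorem one_sub_C_mul_X_mul_mk_pow (μ : ℂ) :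
    (1 - C μ * X) * (PowerSeries.mk fun n => μ ^ n) = (1 : ℂ⟦X⟧) := by
  ext n
  rcases n with _ | n
  · simp
  · rw [sub_mul, one_mul, mul_assoc, map_sub, coeff_C_mul, coeff_succ_X_mul]
    simp [coeff_one, pow_succ']

theorem coe_geomPoly {μ : ℂ} {n : ℕ} (h : μ ^ n = 1) :
    (geomPoly μ n : ℂ⟦X⟧) = (1 - X ^ n) * PowerSeries.mk fun k => μ ^ k := by
  have h1 := congrArg (Polynomial.toPowerSeries) (one_sub_mul_geomPoly μ n)
  rw [mul_pow, ← Polynomial.C_pow, h] at h1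
  simp only [Polynomial.coe_mul, Polynomial.coe_sub, Polynomial.coe_one, Polynomial.coe_C,
    Polynomial.coe_X, Polynomial.coe_pow, map_one, one_mul] at h1
  rw [← h1, mul_right_comm, one_sub_C_mul_X_mul_mk_pow, one_mul]

theorem coe_rootNumerator {a b c : ℕ} (hc : 0 < c) :
    (rootNumerator a b c : ℂ⟦X⟧) = (1 - X ^ a) * (1 - X ^ b) * (1 - X ^ c) *
      PowerSeries.mk fun t => fourierDedekind (-(t : ℤ)) a b c := by
  have hmk : (PowerSeries.mk fun t => fourierDedekind (-(t : ℤ)) a b c) = ∑ z ∈ nontrivialRoots c,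
      C (1 / (c * ((z ^ a - 1) * (z ^ b - 1)))) * PowerSeries.mk fun k => z⁻¹ ^ k := by
    ext t
    simp only [coeff_mk, map_sum, coeff_C_mul, fourierDedekind_eq_sum_nontrivialRoots _ _ _ hc,
      Finset.mul_sum]
    refine Finset.sum_congr rfl fun z _ => ?_
    rw [zpow_neg, zpow_natCast, inv_pow]
    simp only [div_eq_mul_inv, mul_inv]
    ring
  have hsum : ((∑ z ∈ nontrivialRoots c, Polynomial.C (1 / (c * ((z ^ a - 1) * (z ^ b - 1)))) *
      geomPoly z⁻¹ c : Polynomial ℂ) : ℂ⟦X⟧) = (1 - X ^ c) * ∑ z ∈ nontrivialRoots c,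
      C (1 / (c * ((z ^ a - 1) * (z ^ b - 1)))) * PowerSeries.mk fun k => z⁻¹ ^ k := by
    rw [← Polynomial.coeToPowerSeries.ringHom_apply, map_sum, Finset.mul_sum]
    refine Finset.sum_congr rfl fun z hz => ?_
    have hz := ((mem_nontrivialRoots hc).1 hz).2
    rw [map_mul, Polynomial.coeToPowerSeries.ringHom_apply,
      Polynomial.coeToPowerSeries.ringHom_apply, Polynomial.coe_C,
      coe_geomPoly (by rw [inv_pow, hz, inv_one])]
    ring
  rw [rootNumerator, Polynomial.coe_mul, hsum, hmk]
  simp only [Polynomial.coe_mul, Polynomial.coe_sub, Polynomial.coe_one, Polynomial.coe_pow,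
    Polynomial.coe_X]
  ring

theorem coe_oneNumerator {a b c : ℕ} (ha : 0 < a) (hb : 0 < b) (hc : 0 < c) :
    (oneNumerator a b c : ℂ⟦X⟧) = (1 - X ^ a) * (1 - X ^ b) * (1 - X ^ c) *
      PowerSeries.mk fun t : ℕ => (t : ℂ) ^ 2 / (2 * a * b * c) +
        ((t : ℂ) / 2) * (1 / (a * b) + 1 / (a * c) + 1 / (b * c)) + frobConst a b c := by
  have ha0 : (a : ℂ) ≠ 0 := Nat.cast_ne_zero.2 ha.ne'
  have hb0 : (b : ℂ) ≠ 0 := Nat.cast_ne_zero.2 hb.ne'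
  have hc0 : (c : ℂ) ≠ 0 := Nat.cast_ne_zero.2 hc.ne'
  have hgeom (n : ℕ) : (geomPoly 1 n : ℂ⟦X⟧) = (1 - X ^ n) * PowerSeries.mk 1 := by
    rw [coe_geomPoly (one_pow n)]
    congr 2
    ext k
    simp
  have hG : (PowerSeries.mk 1 : ℂ⟦X⟧) * (1 - X) = 1 := mk_one_mul_one_sub_eq_one ℂ
  have hmk : (PowerSeries.mk fun t : ℕ => (t : ℂ) ^ 2 / (2 * a * b * c) +
        ((t : ℂ) / 2) * (1 / (a * b) + 1 / (a * c) + 1 / (b * c)) + frobConst a b c) =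
      C (1 / (a * b * c : ℂ)) * (PowerSeries.mk 1) ^ (2 + 1) +
        C ((a + b + c - 3) / (2 * a * b * c) : ℂ) * (PowerSeries.mk 1) ^ (1 + 1) +
        C (frobConst a b c - (a + b + c - 3) / (2 * a * b * c) - 1 / (a * b * c)) *
          PowerSeries.mk 1 := by
    rw [mk_one_pow_eq_mk_choose_add, mk_one_pow_eq_mk_choose_add]
    ext t
    have hchoose : (((2 + t).choose 2 : ℕ) : ℂ) = (t + 2) * (t + 1) / 2 := by
      rw [Nat.cast_choose_two]
      push_cast
      ring
    simp only [map_add, coeff_C_mul, coeff_mk, hchoose, Nat.choose_one_right, Pi.one_apply]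
    push_cast
    field_simp
    ring
  rw [hmk, oneNumerator]
  simp only [Polynomial.coe_mul, Polynomial.coe_add, Polynomial.coe_sub, Polynomial.coe_one,
    Polynomial.coe_pow, Polynomial.coe_X, Polynomial.coe_C, hgeom]
  generalize (PowerSeries.mk 1 : ℂ⟦X⟧) = G at hG
  generalize C (1 / (a * b * c : ℂ)) = r
  generalize C ((a + b + c - 3) / (2 * a * b * c) : ℂ) = s
  generalize C (frobConst a b c - (a + b + c - 3) / (2 * a * b * c) - 1 / (a * b * c)) = u
  linear_combination (1 - X ^ a) * (1 - X ^ b) * (1 - X ^ c) *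
    (s * G ^ 2 + u * G * (G * (1 - X) + 1)) * hG

theorem one_sub_X_pow_mul_mk_dvd {n : ℕ} (hn : 0 < n) :
    (1 - X ^ n) * (PowerSeries.mk fun k => if n ∣ k then 1 else 0) = (1 : ℂ⟦X⟧) := by
  ext k
  rw [sub_mul, one_mul, map_sub, coeff_X_pow_mul', coeff_one]
  simp only [coeff_mk]
  by_cases hk : n ≤ k
  · have h0 : k ≠ 0 := by omega
    have h : n ∣ k - n ↔ n ∣ k := by
      rw [← Nat.dvd_add_self_right (m := n) (n := k - n), Nat.sub_add_cancel hk]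
    simp [hk, h0, h]
  · have : n ∣ k ↔ k = 0 := ⟨fun h => Nat.eq_zero_of_dvd_of_lt h (by omega), fun h => by simp [h]⟩
    simp [hk, this]

theorem mk_frobN {a b c : ℕ} (ha : 0 < a) (hb : 0 < b) (hc : 0 < c) :
    (PowerSeries.mk fun t => (frobN a b c t : ℂ)) =
      (PowerSeries.mk fun k => if a ∣ k then 1 else 0) *
        ((PowerSeries.mk fun k => if b ∣ k then 1 else 0) *
          (PowerSeries.mk fun k => if c ∣ k then 1 else 0)) := by
  ext t
  simp only [coeff_mul, coeff_mk, Finset.mul_sum, Finset.sum_sigma', ← ite_and, mul_ite, mul_one,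
    mul_zero]
  rw [Finset.sum_boole, frobN]
  congr 1
  rw [← Nat.card_eq_finsetCard]
  refine Nat.card_eq_of_bijective (fun p => ⟨⟨(a * p.1.1, b * p.1.2.1 + c * p.1.2.2),
    (b * p.1.2.1, c * p.1.2.2)⟩, ?_⟩) ⟨?_, ?_⟩
  · have := p.2
    simp only [Finset.mem_filter, Finset.mem_sigma, Finset.HasAntidiagonal.mem_antidiagonal,
      dvd_mul_right, and_true]
    omega
  · rintro ⟨⟨m₁, m₂, m₃⟩, h⟩ ⟨⟨n₁, n₂, n₃⟩, h'⟩ heq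
    simp only [Subtype.mk.injEq, Sigma.mk.injEq, Prod.mk.injEq, heq_eq_eq,
      mul_eq_mul_left_iff, ha.ne', hb.ne', hc.ne', or_false] at heq
    simp [heq]
  · rintro ⟨⟨⟨i, r⟩, ⟨j, k⟩⟩, h⟩
    simp only [Finset.mem_filter, Finset.mem_sigma, Finset.HasAntidiagonal.mem_antidiagonal] at h
    obtain ⟨⟨rfl, rfl⟩, ⟨⟨m₃, rfl⟩, ⟨m₂, rfl⟩⟩, ⟨m₁, rfl⟩⟩ := h
    exact ⟨⟨(m₁, m₂, m₃), by simp [add_assoc]⟩, rfl⟩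

end PowerSeries

/-- For pairwise coprime positive integers `a, b, c` and `t ≥ 0`:
`N_t(a,b,c) = t²/(2abc) + (t/2)(1/(ab) + 1/(ac) + 1/(bc))
+ (1/12)(3/a + 3/b + 3/c + a/(bc) + b/(ac) + c/(ab))
+ σ_{-t}(b,c;a) + σ_{-t}(a,c;b) + σ_{-t}(a,b;c)`. -/
theorem frobN_eq_polynomial_add_fourierDedekind (a b c : ℕ)
    (ha : 0 < a) (hb : 0 < b) (hc : 0 < c)
    (hab : Nat.Coprime a b) (hac : Nat.Coprime a c) (hbc : Nat.Coprime b c)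
    (t : ℕ) :
    (frobN a b c t : ℂ) =
      (t : ℂ) ^ 2 / (2 * a * b * c) +
        ((t : ℂ) / 2) * (1 / (a * b) + 1 / (a * c) + 1 / (b * c)) +
        (1 / 12) * (3 / a + 3 / b + 3 / c + a / (b * c) + b / (a * c) + c / (a * b)) +
        fourierDedekind (-(t : ℤ)) b c a +
        fourierDedekind (-(t : ℤ)) a c b +
        fourierDedekind (-(t : ℤ)) a b c := by
  have hone := congrArg Polynomial.toPowerSeries
    (oneNumerator_add_rootNumerator ha hb hc hab hac hbc)
  simp only [Polynomial.coe_add, Polynomial.coe_one, coe_oneNumerator ha hb hc,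
    coe_rootNumerator ha, coe_rootNumerator hb, coe_rootNumerator hc] at hone
  have hD : (1 - PowerSeries.X ^ a) * (1 - PowerSeries.X ^ b) * (1 - PowerSeries.X ^ c) *
      (PowerSeries.mk fun t => (frobN a b c t : ℂ)) = 1 := by
    rw [mk_frobN ha hb hc, mul_assoc _ _ (1 - PowerSeries.X ^ c), mul_mul_mul_comm,
      mul_mul_mul_comm (1 - PowerSeries.X ^ b), one_sub_X_pow_mul_mk_dvd ha,
      one_sub_X_pow_mul_mk_dvd hb, one_sub_X_pow_mul_mk_dvd hc, one_mul, one_mul]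
  have hcancel {x y z N P Q R S : PowerSeries ℂ} (hxyz : x * y * z * N = 1)
      (h : x * y * z * P + y * z * x * Q + x * z * y * R + x * y * z * S = 1) :
      N = P + Q + R + S := by
    linear_combination (P + Q + R + S) * hxyz - N * h
  simpa only [map_add, PowerSeries.coeff_mk, frobConst] using
    congrArg (PowerSeries.coeff t) (hcancel hD hone)
end
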